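/- arXiv:2211.17245 — 2 statements merged into one kernel-verified Lean document; each statement's English description precedes it below -/
import Mathlib

section
/- Let φ : L⁰ → [−∞,∞] be a monetary risk measure such that the restriction of φ to L^∞ is convex and continuous from below on L^∞, and suppose there exists a measurable function I : X → [0,∞] such that φ*(ν) = ∫_X I dν for every probability measure ν on 𝒳 with ν ≪ μ, where φ*(ν) := sup_{f ∈ L^∞} ( ∫_X f dν − φ(f) ) is the convex conjugate of φ|_{L^∞}. Then φ(f) = ess.sup_X(f − I) for every f ∈ L^∞. -/
open MeasureTheory Filter Set Topology ENNReal

noncomputable section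

variable {X : Type*} [MeasurableSpace X]

/-- Membership in `L^∞(μ)`. -/
def MemLinf (μ : Measure X) (f : X → ℝ) : Prop :=
  Measurable f ∧ ∃ C : ℝ, ∀ᵐ x ∂μ, |f x| ≤ C

/-- A monetary risk measure on `L⁰`. -/
def IsMonetaryRiskMeasure (μ : Measure X) (φ : (X → ℝ) → EReal) : Prop :=
  φ (fun _ => 0) = 0 ∧
    (∀ f g : X → ℝ, Measurable f → Measurable g → (∀ᵐ x ∂μ, f x ≤ g x) → φ f ≤ φ g) ∧
    (∀ f : X → ℝ, Measurable f → ∀ c : ℝ, φ (fun x => f x + c) = φ f + (c : EReal))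

/-- `φ` is convex on `L^∞`. -/
def ConvexLinf (μ : Measure X) (φ : (X → ℝ) → EReal) : Prop :=
  ∀ f g : X → ℝ, MemLinf μ f → MemLinf μ g → ∀ t : ℝ, t ∈ Set.Ioo (0:ℝ) 1 →
    φ (fun x => t * f x + (1 - t) * g x) ≤ (t : EReal) * φ f + ((1 - t : ℝ) : EReal) * φ g

/-- `φ` is continuous from below on `L^∞`. -/
def ContFromBelowLinf (μ : Measure X) (φ : (X → ℝ) → EReal) : Prop :=
  ∀ (f : ℕ → X → ℝ) (g : X → ℝ), (∀ n, MemLinf μ (f n)) → MemLinf μ g →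
    (∀ᵐ x ∂μ, Monotone fun n => f n x) →
    (∀ᵐ x ∂μ, Tendsto (fun n => f n x) atTop (𝓝 (g x))) →
    (⨆ n, φ (f n)) = φ g

theorem nonempty_iInter_of_antitone_closed_convex {E : Type*} [NormedAddCommGroup E]
    [InnerProductSpace ℝ E] [CompleteSpace E] {S : ℕ → Set E} (hanti : Antitone S)
    (hne : ∀ n, (S n).Nonempty) (hcl : ∀ n, IsClosed (S n)) (hconv : ∀ n, Convex ℝ (S n))
    {R : ℝ} (hbdd : ∀ n, ∀ v ∈ S n, ‖v‖ ≤ R) : (⋂ n, S n).Nonempty := by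
  have hmin : ∀ n, ∃ p ∈ S n, ∀ w ∈ S n, ‖p‖ ≤ ‖w‖ := by
    intro n
    obtain ⟨p, hp, hpe⟩ :=
      exists_norm_eq_iInf_of_complete_convex (hne n) (hcl n).isComplete (hconv n) 0
    refine ⟨p, hp, fun w hw => ?_⟩
    have := ciInf_le (f := fun w : S n => ‖(0 : E) - w‖)
      ⟨0, Set.forall_mem_range.2 fun _ => norm_nonneg _⟩ ⟨w, hw⟩
    rw [← hpe] at this
    simpa using this
  choose p hpS hpmin using hmin
  have hmono : Monotone fun n => ‖p n‖ ^ 2 := fun m n hmn =>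
    pow_le_pow_left₀ (norm_nonneg _) (hpmin m _ (hanti hmn (hpS n))) 2
  have hlim := tendsto_atTop_ciSup hmono
    ⟨R ^ 2, Set.forall_mem_range.2 fun n =>
      pow_le_pow_left₀ (norm_nonneg _) (hbdd n _ (hpS n)) 2⟩
  have hdist : ∀ m n, m ≤ n → dist (p m) (p n) ^ 2 ≤ 2 * (‖p n‖ ^ 2 - ‖p m‖ ^ 2) := by
    intro m n hmn
    have hmid : (1 / 2 : ℝ) • p m + (1 / 2 : ℝ) • p n ∈ S m :=
      hconv m (hpS m) (hanti hmn (hpS n)) (by norm_num) (by norm_num) (by norm_num)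
    have h1 := hpmin m _ hmid
    rw [← smul_add, norm_smul, Real.norm_of_nonneg (by norm_num)] at h1
    have h2 := parallelogram_law_with_norm ℝ (p m) (p n)
    rw [dist_eq_norm]
    nlinarith [norm_nonneg (p m), norm_nonneg (p m + p n)]
  have hcauchy : CauchySeq p := by
    rw [Metric.cauchySeq_iff']
    intro ε hε
    obtain ⟨N, hN⟩ := Metric.cauchySeq_iff'.1 hlim.cauchySeq (ε ^ 2 / 2) (by positivity)
    refine ⟨N, fun n hn => ?_⟩
    have h1 := hN n hn
    rw [Real.dist_eq] at h1
    have h2 := hdist N n hn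
    rw [dist_comm]
    refine lt_of_pow_lt_pow_left₀ 2 hε.le ?_
    linarith [le_abs_self (‖p n‖ ^ 2 - ‖p N‖ ^ 2)]
  obtain ⟨q, hq⟩ := cauchySeq_tendsto_of_complete hcauchy
  refine ⟨q, Set.mem_iInter.2 fun n => (hcl n).mem_of_tendsto hq ?_⟩
  filter_upwards [eventually_ge_atTop n] with m hm using hanti hm (hpS m)

/-- A convex set of bounded functions that is upward closed and stable under bounded almost
everywhere convergence. -/
structure IsFatouUpperSet (μ : Measure X) (U : Set (X → ℝ)) : Prop where
  memLinf : ∀ u ∈ U, MemLinf μ u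
  convex : ∀ u ∈ U, ∀ v ∈ U, ∀ t ∈ Set.Ioo (0 : ℝ) 1, (fun x => t * u x + (1 - t) * v x) ∈ U
  mono : ∀ u ∈ U, ∀ v, MemLinf μ v → (∀ᵐ x ∂μ, u x ≤ v x) → v ∈ U
  closed : ∀ (u : ℕ → X → ℝ) (v : X → ℝ) (C : ℝ), (∀ n, u n ∈ U) →
    (∀ n, ∀ᵐ x ∂μ, |u n x| ≤ C) → MemLinf μ v →
    (∀ᵐ x ∂μ, Tendsto (fun n => u n x) atTop (𝓝 (v x))) → v ∈ U

namespace MemLinf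

variable {μ : Measure X}

theorem const (c : ℝ) : MemLinf μ fun _ => c :=
  ⟨measurable_const, |c|, .of_forall fun _ => le_rfl⟩

theorem add {f g : X → ℝ} (hf : MemLinf μ f) (hg : MemLinf μ g) :
    MemLinf μ fun x => f x + g x := by
  obtain ⟨hfm, C, hC⟩ := hf
  obtain ⟨hgm, D, hD⟩ := hg
  refine ⟨hfm.add hgm, C + D, ?_⟩
  filter_upwards [hC, hD] with x h1 h2
  exact (abs_add_le _ _).trans (add_le_add h1 h2)

theorem const_mul {f : X → ℝ} (hf : MemLinf μ f) (c : ℝ) : MemLinf μ fun x => c * f x := by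
  obtain ⟨hfm, C, hC⟩ := hf
  refine ⟨hfm.const_mul c, |c| * C, ?_⟩
  filter_upwards [hC] with x h1
  rw [abs_mul]
  gcongr

theorem sub {f g : X → ℝ} (hf : MemLinf μ f) (hg : MemLinf μ g) :
    MemLinf μ fun x => f x - g x := by
  simpa [sub_eq_add_neg] using hf.add (hg.const_mul (-1))

theorem max_zero {f : X → ℝ} (hf : MemLinf μ f) : MemLinf μ fun x => max (f x) 0 := by
  obtain ⟨hfm, C, hC⟩ := hf
  refine ⟨hfm.max measurable_const, C, ?_⟩
  filter_upwards [hC] with x h1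
  rw [abs_of_nonneg (le_max_right _ _)]
  exact max_le ((le_abs_self _).trans h1) ((abs_nonneg _).trans h1)

theorem indicator {A : Set X} (hA : MeasurableSet A) :
    MemLinf μ (A.indicator fun _ => (1 : ℝ)) := by
  refine ⟨measurable_const.indicator hA, 1, .of_forall fun x => ?_⟩
  by_cases hx : x ∈ A <;> simp [hx]

theorem of_mem_Icc {f : X → ℝ} (hf : Measurable f) {a b : ℝ}
    (h : ∀ᵐ x ∂μ, f x ∈ Set.Icc a b) : MemLinf μ f := by
  refine ⟨hf, max |a| |b|, ?_⟩
  filter_upwards [h] with x hx using abs_le_max_abs_abs hx.1 hx.2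

theorem memLp {f : X → ℝ} (hf : MemLinf μ f) : MemLp f ∞ μ :=
  let ⟨C, hC⟩ := hf.2
  memLp_top_of_bound hf.1.aestronglyMeasurable C hC

theorem comp_continuous {f : X → ℝ} (hf : MemLinf μ f) {Φ : ℝ → ℝ} (hΦ : Continuous Φ) :
    MemLinf μ fun x => Φ (f x) := by
  obtain ⟨hfm, C, hC⟩ := hf
  obtain ⟨D, hD⟩ := (isCompact_Icc (a := -C) (b := C)).exists_bound_of_continuousOn
    hΦ.continuousOn
  refine ⟨hΦ.measurable.comp hfm, D, ?_⟩
  filter_upwards [hC] with x hx using hD _ (abs_le.1 hx)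

theorem integrable [IsFiniteMeasure μ] {f : X → ℝ} (hf : MemLinf μ f) : Integrable f μ :=
  hf.memLp.integrable le_top

end MemLinf

namespace IsFatouUpperSet

variable {μ : Measure X} {U : Set (X → ℝ)} {Φ : ℝ → ℝ}

theorem mem_of_ae_eq (hU : IsFatouUpperSet μ U) {u v : X → ℝ} (hu : u ∈ U) (hv : Measurable v)
    (h : ∀ᵐ x ∂μ, u x = v x) : v ∈ U := by
  obtain ⟨-, C, hC⟩ := hU.memLinf u hu
  refine hU.mono u hu v ⟨hv, C, ?_⟩ (h.mono fun x hx => hx.le)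
  filter_upwards [h, hC] with x h1 h2 using h1 ▸ h2

/-- The elements of `U` with values in `[0, b]` on which the modular of `Φ` is at most one. -/
def sublevel (U : Set (X → ℝ)) (μ : Measure X) (Φ : ℝ → ℝ) (b : ℝ) : Set (Lp ℝ 2 μ) :=
  {v | (v : X → ℝ) ∈ U ∧ (∀ᵐ x ∂μ, v x ∈ Set.Icc 0 b) ∧ ∫ x, Φ (v x) ∂μ ≤ 1}

theorem convex_sublevel [IsFiniteMeasure μ] (hU : IsFatouUpperSet μ U)
    (hΦ : ConvexOn ℝ Set.univ Φ) (hΦc : Continuous Φ) (b : ℝ) :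
    Convex ℝ (sublevel U μ Φ b) := by
  rw [convex_iff_forall_pos]
  rintro v ⟨hvU, hvb, hvΦ⟩ w ⟨hwU, hwb, hwΦ⟩ s t hs ht hst
  obtain rfl : t = 1 - s := by linarith
  have hcoe : ∀ᵐ x ∂μ, (s • v + (1 - s) • w : Lp ℝ 2 μ) x = s * v x + (1 - s) * w x := by
    filter_upwards [Lp.coeFn_add (s • v) ((1 - s) • w), Lp.coeFn_smul s v,
      Lp.coeFn_smul (1 - s) w] with x h1 h2 h3
    rw [h1, Pi.add_apply, h2, h3]
    rfl
  have hmem : (⇑(s • v + (1 - s) • w) : X → ℝ) ∈ U := by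
    refine hU.mem_of_ae_eq (hU.convex _ hvU _ hwU s ⟨hs, by linarith⟩)
      (Lp.stronglyMeasurable _).measurable ?_
    filter_upwards [hcoe] with x hx using hx.symm
  refine ⟨hmem, ?_, ?_⟩
  · filter_upwards [hcoe, hvb, hwb] with x h1 h2 h3
    rw [h1]
    exact convex_Icc 0 b h2 h3 hs.le ht.le hst
  · have hv := ((hU.memLinf _ hvU).comp_continuous hΦc).integrable
    have hw := ((hU.memLinf _ hwU).comp_continuous hΦc).integrable
    have hle : ∫ x, Φ ((s • v + (1 - s) • w : Lp ℝ 2 μ) x) ∂μ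
        ≤ ∫ x, (s * Φ (v x) + (1 - s) * Φ (w x)) ∂μ := by
      refine integral_mono_ae ((hU.memLinf _ hmem).comp_continuous hΦc).integrable
        ((hv.const_mul s).add (hw.const_mul _)) ?_
      filter_upwards [hcoe] with x hx
      simpa only [hx, smul_eq_mul] using
        hΦ.2 (Set.mem_univ (v x)) (Set.mem_univ (w x)) hs.le ht.le hst
    rw [integral_add (hv.const_mul s) (hw.const_mul _), integral_const_mul,
      integral_const_mul] at hle
    nlinarith

theorem isClosed_sublevel [IsFiniteMeasure μ] (hU : IsFatouUpperSet μ U)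
    (hΦc : Continuous Φ) (b : ℝ) : IsClosed (sublevel U μ Φ b) := by
  refine IsSeqClosed.isClosed fun v w hv hvw => ?_
  obtain ⟨k, -, hk⟩ := (tendstoInMeasure_of_tendsto_Lp hvw).exists_seq_tendsto_ae
  have hb : ∀ᵐ x ∂μ, ∀ n, v n x ∈ Set.Icc 0 b := ae_all_iff.2 fun n => (hv n).2.1
  have hwb : ∀ᵐ x ∂μ, w x ∈ Set.Icc 0 b := by
    filter_upwards [hk, hb] with x h1 h2
    exact isClosed_Icc.mem_of_tendsto h1 (.of_forall fun n => h2 _)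
  refine ⟨?_, hwb, ?_⟩
  · refine hU.closed (fun n => v (k n)) w b (fun n => (hv _).1) (fun n => ?_)
      (.of_mem_Icc (Lp.stronglyMeasurable _).measurable hwb) hk
    filter_upwards [hb] with x hx
    rw [abs_of_nonneg (hx _).1]
    exact (hx _).2
  · obtain ⟨D, hD⟩ := (isCompact_Icc (a := (0 : ℝ)) (b := b)).exists_bound_of_continuousOn
      hΦc.continuousOn
    refine le_of_tendsto (tendsto_integral_of_dominated_convergence
      (F := fun n x => Φ (v (k n) x)) (fun _ => D)
      (fun n => (hΦc.comp_aestronglyMeasurable (Lp.aestronglyMeasurable _))) (integrable_const D)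
      (fun n => ?_) ?_) (.of_forall fun n => (hv (k n)).2.2)
    · filter_upwards [hb] with x hx using hD _ (hx _)
    · filter_upwards [hk] with x hx using (hΦc.tendsto _).comp hx

theorem exists_penalty [IsFiniteMeasure μ] (hU : IsFatouUpperSet μ U)
    (hΦ : ConvexOn ℝ Set.univ Φ) (hΦc : Continuous Φ) {b : ℝ} (hb : 0 ≤ b)
    (h : ∀ u ∈ U, (∀ᵐ x ∂μ, u x ∈ Set.Icc 0 b) → 1 < ∫ x, Φ (u x) ∂μ) :
    ∃ c : ℝ, 0 ≤ c ∧ ∀ u ∈ U, (∀ᵐ x ∂μ, u x ∈ Set.Icc 0 (b + 1)) →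
      1 < ∫ x, (Φ (u x) + c * max (u x - b) 0) ∂μ := by
  by_contra! hcon
  let Ψ : ℕ → ℝ → ℝ := fun k s => Φ s + k * max (s - b) 0
  have hΨc : ∀ k, Continuous (Ψ k) := fun k => by fun_prop
  have hΨ : ∀ k, ConvexOn ℝ Set.univ (Ψ k) := fun k => by
    refine hΦ.add (ConvexOn.smul (c := (k : ℝ)) k.cast_nonneg (ConvexOn.sup ?_ ?_))
    · exact (convexOn_id convex_univ).sub (concaveOn_const b convex_univ)
    · exact convexOn_const 0 convex_univ
  obtain ⟨v, hv⟩ : (⋂ k, sublevel U μ (Ψ k) (b + 1)).Nonempty := by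
    refine nonempty_iInter_of_antitone_closed_convex
      (R := (measureUnivNNReal μ : ℝ) ^ (2 : ℝ)⁻¹ * (b + 1))
      ?_ ?_ (fun k => hU.isClosed_sublevel (hΨc k) _)
      (fun k => hU.convex_sublevel (hΨ k) (hΨc k) _) ?_
    · rintro k l hkl w ⟨hwU, hwb, hw1⟩
      have hwL := hU.memLinf _ hwU
      refine ⟨hwU, hwb, le_trans (integral_mono (hwL.comp_continuous (hΨc k)).integrable
        (hwL.comp_continuous (hΨc l)).integrable fun x => ?_) hw1⟩
      have : (k : ℝ) ≤ l := by exact_mod_cast hkl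
      simp only [Ψ]
      gcongr
    · intro k
      obtain ⟨u, huU, hub, hu1⟩ := hcon k k.cast_nonneg
      have hmem := (hU.memLinf u huU).memLp.mono_exponent (p := 2) le_top
      have hcoe := hmem.coeFn_toLp
      refine ⟨hmem.toLp u, hU.mem_of_ae_eq huU (Lp.stronglyMeasurable _).measurable ?_, ?_, ?_⟩
      · filter_upwards [hcoe] with x hx using hx.symm
      · filter_upwards [hcoe, hub] with x hx h2 using hx ▸ h2
      · refine le_of_eq_of_le (integral_congr_ae ?_) hu1
        filter_upwards [hcoe] with x hx
        simp only [Ψ, hx]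
    · intro k w hw
      have := Lp.norm_le_of_ae_bound (f := w) (C := b + 1) (by linarith) (by
        filter_upwards [hw.2.1] with x hx
        rw [Real.norm_of_nonneg hx.1]
        exact hx.2)
      simpa using this
  have hvk : ∀ k, v ∈ sublevel U μ (Ψ k) (b + 1) := Set.mem_iInter.1 hv
  have hvL := hU.memLinf _ (hvk 0).1
  have hpos := ((hvL.sub (.const b)).max_zero).integrable
  have hint := (hvL.comp_continuous hΦc).integrable
  have hle : ∀ k : ℕ, ∫ x, Φ (v x) ∂μ + k * ∫ x, max (v x - b) 0 ∂μ ≤ 1 := fun k => by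
    rw [← integral_const_mul, ← integral_add hint (hpos.const_mul _)]
    exact (hvk k).2.2
  have hzero : ∫ x, max (v x - b) 0 ∂μ = 0 := by
    refine le_antisymm (not_lt.1 fun hlt => ?_) (integral_nonneg fun x => le_max_right _ _)
    obtain ⟨k, hk⟩ := exists_nat_gt ((1 - ∫ x, Φ (v x) ∂μ) / ∫ x, max (v x - b) 0 ∂μ)
    rw [div_lt_iff₀ hlt] at hk
    linarith [hle k]
  replace hzero := (integral_eq_zero_iff_of_nonneg (f := fun x => max (v x - b) 0)
    (fun x => le_max_right _ _) hpos).1 hzero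
  have := h v (hvk 0).1 (by
    filter_upwards [hzero, (hvk 0).2.1] with x h1 h2
    refine ⟨h2.1, ?_⟩
    have h3 : max (v x - b) 0 = 0 := h1
    linarith [le_max_left (v x - b) 0])
  have h0 := hle 0
  simp only [Nat.cast_zero, zero_mul, add_zero] at h0
  linarith

end IsFatouUpperSet

/-- A monotone linear functional on `L^∞` that is continuous along sequences of sets decreasing to
the empty set is bounded above by the integral against a finite measure. -/
theorem exists_measure_of_linear_of_mono {μ : Measure X} (L : (X → ℝ) → ℝ)
    (hadd : ∀ u v, MemLinf μ u → MemLinf μ v → L (fun x => u x + v x) = L u + L v)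
    (hmul : ∀ u, MemLinf μ u → ∀ c : ℝ, L (fun x => c * u x) = c * L u)
    (hmono : ∀ u v, MemLinf μ u → MemLinf μ v → (∀ᵐ x ∂μ, u x ≤ v x) → L u ≤ L v)
    (hlim : ∀ A : ℕ → Set X, (∀ n, MeasurableSet (A n)) → Antitone A → ⋂ n, A n = ∅ →
      Tendsto (fun n => L ((A n).indicator fun _ => 1)) atTop (𝓝 0)) :
    ∃ ν : Measure X, IsFiniteMeasure ν ∧ ν ≪ μ ∧ ∀ u, MemLinf μ u → L u ≤ ∫ x, u x ∂ν := by
  have hzero : L (fun _ => 0) = 0 := by simpa using hmul _ (.const 0) 0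
  have hnonneg : ∀ u, MemLinf μ u → (∀ᵐ x ∂μ, 0 ≤ u x) → 0 ≤ L u := fun u hu h =>
    hzero.symm.le.trans (hmono _ _ (.const 0) hu h)
  have hind : ∀ {A : Set X}, MeasurableSet A → 0 ≤ L (A.indicator fun _ => 1) := fun hA =>
    hnonneg _ (.indicator hA) (.of_forall fun x => Set.indicator_nonneg (by simp) x)
  let ν : Measure X := Measure.ofMeasurable
    (fun A _ => ENNReal.ofReal (L (A.indicator fun _ => 1))) (by simp [hzero]) (by
    intro A hA hdisj
    let R : ℕ → Set X := fun n => ⋃ i ∈ Set.Ici n, A i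
    have hR : ∀ n, MeasurableSet (R n) := fun n =>
      MeasurableSet.biUnion (Set.to_countable _) fun i _ => hA i
    have hRanti : Antitone R := fun m n hmn =>
      Set.biUnion_subset_biUnion_left (Set.Ici_subset_Ici.2 hmn)
    have huniq : ∀ {i j x}, x ∈ A i → x ∈ A j → i = j := fun {i j x} hi hj => by
      by_contra hne
      exact Set.disjoint_left.1 (hdisj hne) hi hj
    have hRempty : ⋂ n, R n = ∅ := by
      refine Set.eq_empty_iff_forall_notMem.2 fun x hx => ?_
      rw [Set.mem_iInter] at hx
      obtain ⟨i, -, hi⟩ := Set.mem_iUnion₂.1 (hx 0)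
      obtain ⟨j, hj, hj'⟩ := Set.mem_iUnion₂.1 (hx (i + 1))
      have := huniq hi hj'
      simp only [Set.mem_Ici] at hj
      omega
    have hstep : ∀ n, L ((R n).indicator fun _ => 1)
        = L ((A n).indicator fun _ => 1) + L ((R (n + 1)).indicator fun _ => 1) := fun n => by
      rw [← hadd _ _ (.indicator (hA n)) (.indicator (hR _))]
      congr 1
      have hRn : R n = A n ∪ R (n + 1) := by
        ext x
        simp only [R, Set.mem_union, Set.mem_iUnion₂, Set.mem_Ici, exists_prop]
        constructor
        · rintro ⟨i, hi, hx⟩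
          rcases hi.eq_or_lt with rfl | hi
          · exact .inl hx
          · exact .inr ⟨i, hi, hx⟩
        · rintro (hx | ⟨i, hi, hx⟩)
          · exact ⟨n, le_rfl, hx⟩
          · exact ⟨i, by omega, hx⟩
      have hd : Disjoint (A n) (R (n + 1)) := by
        refine Set.disjoint_left.2 fun x hx hx' => ?_
        obtain ⟨j, hj, hj'⟩ := Set.mem_iUnion₂.1 hx'
        have := huniq hx hj'
        simp only [Set.mem_Ici] at hj
        omega
      rw [hRn, Set.indicator_union_of_disjoint hd]
    have hsum : ∀ n, ∑ i ∈ Finset.range n, L ((A i).indicator fun _ => 1)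
        = L ((R 0).indicator fun _ => 1) - L ((R n).indicator fun _ => 1) := fun n => by
      induction n with
      | zero => simp
      | succ n ih => rw [Finset.sum_range_succ, ih, hstep n]; ring
    have hhas : HasSum (fun i => L ((A i).indicator fun _ => 1))
        (L ((R 0).indicator fun _ => 1)) := by
      rw [hasSum_iff_tendsto_nat_of_nonneg fun i => hind (hA i)]
      simp_rw [hsum]
      simpa using (hlim R hR hRanti hRempty).const_sub (L ((R 0).indicator fun _ => 1))
    have hR0 : ⋃ i, A i = R 0 := by simp [R]
    rw [hR0, ← hhas.tsum_eq, ENNReal.ofReal_tsum_of_nonneg (fun i => hind (hA i)) hhas.summable])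
  have hν : ∀ {A : Set X}, MeasurableSet A → ν A = ENNReal.ofReal (L (A.indicator fun _ => 1)) :=
    fun hA => Measure.ofMeasurable_apply _ hA
  have hfin : IsFiniteMeasure ν := ⟨by rw [hν .univ]; exact ENNReal.ofReal_lt_top⟩
  have hac : ν ≪ μ := Measure.AbsolutelyContinuous.mk fun A hA h0 => by
    rw [hν hA, ENNReal.ofReal_eq_zero, ← hzero]
    refine hmono _ _ (.indicator hA) (.const 0) ?_
    filter_upwards [measure_eq_zero_iff_ae_notMem.1 h0] with x hx
    simp [hx]
  have hsimpleL : ∀ s : SimpleFunc X NNReal, MemLinf μ fun x => (s x : ℝ) := fun s => by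
    obtain ⟨C, hC⟩ := (s.map ((↑) : NNReal → ℝ)).exists_forall_norm_le
    exact ⟨(s.map ((↑) : NNReal → ℝ)).measurable, C, .of_forall hC⟩
  have hsimple : ∀ s : SimpleFunc X NNReal,
      ∫⁻ x, (s x : ℝ≥0∞) ∂ν = ENNReal.ofReal (L fun x => (s x : ℝ)) := fun s => by
    induction s using SimpleFunc.induction with
    | const c hs =>
      rename_i A
      have h1 : ∀ x, ((SimpleFunc.piecewise A hs (.const X c) (.const X 0) x : NNReal) : ℝ≥0∞)
          = A.indicator (fun _ => (c : ℝ≥0∞)) x := fun x => by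
        by_cases hx : x ∈ A <;> simp [hx]
      have h2 : ∀ x, ((SimpleFunc.piecewise A hs (.const X c) (.const X 0) x : NNReal) : ℝ)
          = c * A.indicator (fun _ => (1 : ℝ)) x := fun x => by
        by_cases hx : x ∈ A <;> simp [hx]
      simp_rw [h1, h2]
      rw [lintegral_indicator_const hs, hν hs, hmul _ (.indicator hs),
        ENNReal.ofReal_mul c.coe_nonneg, ENNReal.ofReal_coe_nnreal]
    | @add f g hd hf hg =>
      simp only [SimpleFunc.coe_add, Pi.add_apply, ENNReal.coe_add, NNReal.coe_add]
      rw [lintegral_add_left (by fun_prop), hf, hg, hadd _ _ (hsimpleL f) (hsimpleL g),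
        ENNReal.ofReal_add (hnonneg _ (hsimpleL f) (.of_forall fun x => (f x).coe_nonneg))
          (hnonneg _ (hsimpleL g) (.of_forall fun x => (g x).coe_nonneg))]
  have hle : ∀ w, MemLinf μ w → (∀ᵐ x ∂μ, 0 ≤ w x) → ∫ x, w x ∂ν ≤ L w := fun w hw hw0 => by
    rw [integral_eq_lintegral_of_nonneg_ae (hac.ae_le hw0) hw.1.aestronglyMeasurable]
    refine ENNReal.toReal_le_of_le_ofReal (hnonneg w hw hw0) ?_
    rw [lintegral_eq_nnreal]
    refine iSup₂_le fun s hs => ?_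
    rw [← SimpleFunc.lintegral_eq_lintegral]
    refine le_of_eq_of_le (hsimple s) (ENNReal.ofReal_le_ofReal (hmono _ _ (hsimpleL s) hw ?_))
    filter_upwards [hw0] with x hx
    have := hs x
    rwa [← ENNReal.ofReal_coe_nnreal, ENNReal.ofReal_le_ofReal_iff hx] at this
  refine ⟨ν, hfin, hac, fun u hu => ?_⟩
  obtain ⟨hum, C, hC⟩ := id hu
  have hintegrable : Integrable u ν :=
    MemLinf.integrable (⟨hum, C, hac.ae_le hC⟩ : MemLinf ν u)
  have h1 := hle _ (((MemLinf.const C).add (hu.const_mul (-1)))) (by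
    filter_upwards [hC] with x hx
    linarith [le_abs_self (u x)])
  have hone : L (fun _ => C) = C * ν.real Set.univ := by
    have h2 := hmul _ (.const 1) C
    have h3 : ν.real Set.univ = L (fun _ => 1) := by
      rw [Measure.real, hν .univ, Set.indicator_univ,
        ENNReal.toReal_ofReal (hnonneg _ (.const 1) (by simp))]
    rw [h3, ← h2]
    simp
  rw [hadd _ _ (.const C) (hu.const_mul _), hmul _ hu, hone,
    integral_add (integrable_const C) (hintegrable.const_mul _), integral_const_mul,
    integral_const, smul_eq_mul] at h1
  linarith

theorem ae_norm_le_norm_Lp_top {μ : Measure X} (v : Lp ℝ ∞ μ) : ∀ᵐ x ∂μ, ‖v x‖ ≤ ‖v‖ := by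
  filter_upwards [ae_le_eLpNormEssSup (f := v) (μ := μ)] with x hx
  rw [← eLpNorm_exponent_top] at hx
  rw [Lp.norm_def, ← toReal_enorm]
  exact ENNReal.toReal_mono (Lp.eLpNorm_ne_top v) hx

namespace IsFatouUpperSet

variable {μ : Measure X} {U : Set (X → ℝ)}

/-- A convex function on the line, vanishing on `(-∞, 0]`, whose modular exceeds one on the
elements of `U` with values in `[0, n]`. -/
structure IsPenalty (U : Set (X → ℝ)) (μ : Measure X) (n : ℕ) (Ψ : ℝ → ℝ) : Prop where
  convexOn : ConvexOn ℝ Set.univ Ψ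
  continuous : Continuous Ψ
  monotone : Monotone Ψ
  eq_zero : ∀ s ≤ 0, Ψ s = 0
  one_lt : ∀ u ∈ U, (∀ᵐ x ∂μ, u x ∈ Set.Icc 0 (n : ℝ)) → 1 < ∫ x, Ψ (u x) ∂μ

theorem exists_penalty_seq [IsFiniteMeasure μ] (hU : IsFatouUpperSet μ U)
    (h0 : (fun _ => 0) ∉ U) :
    ∃ Ψ : ℕ → ℝ → ℝ, (∀ n, IsPenalty U μ n (Ψ n)) ∧ (∀ s, Monotone fun n => Ψ n s) ∧
      ∀ (n m : ℕ) (s : ℝ), s ≤ n → Ψ m s ≤ Ψ n s := by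
  have hstep : ∀ (n : ℕ) (Ψ : ℝ → ℝ), IsPenalty U μ n Ψ → ∃ c : ℝ, 0 ≤ c ∧
      IsPenalty U μ (n + 1) fun s => Ψ s + c * max (s - n) 0 := fun n Ψ hΨ => by
    obtain ⟨c, hc, hc1⟩ := hU.exists_penalty hΨ.convexOn hΨ.continuous n.cast_nonneg hΨ.one_lt
    refine ⟨c, hc, ?_, ?_, ?_, ?_, by simpa using hc1⟩
    · exact hΨ.convexOn.add (ConvexOn.smul hc (ConvexOn.sup
        ((convexOn_id convex_univ).sub (concaveOn_const _ convex_univ))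
        (convexOn_const 0 convex_univ)))
    · have := hΨ.continuous
      fun_prop
    · intro s t hst
      have := hΨ.monotone hst
      dsimp only
      gcongr
    · intro s hs
      have hn : (0 : ℝ) ≤ n := n.cast_nonneg
      rw [hΨ.eq_zero s hs, max_eq_right (by linarith)]
      simp
  have hbase : IsPenalty U μ 0 fun _ => 0 := by
    refine ⟨convexOn_const 0 convex_univ, continuous_const, monotone_const, fun _ _ => rfl,
      fun u hu h => absurd (hU.mem_of_ae_eq hu measurable_const ?_) h0⟩
    filter_upwards [h] with x hx
    simpa using hx
  choose! c hc hc' using hstep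
  let Ψ : ℕ → ℝ → ℝ := fun n =>
    Nat.rec (fun _ => 0) (fun n Ψ s => Ψ s + c n Ψ * max (s - n) 0) n
  have hΨ : ∀ n, IsPenalty U μ n (Ψ n) := fun n => by
    induction n with
    | zero => exact hbase
    | succ n ih => exact_mod_cast hc' n _ ih
  have hmono : ∀ s, Monotone fun n => Ψ n s := fun s => monotone_nat_of_le_succ fun n =>
    le_add_of_nonneg_right (mul_nonneg (hc n _ (hΨ n)) (le_max_right _ _))
  refine ⟨Ψ, hΨ, hmono, fun n m s hs => ?_⟩
  rcases le_total m n with h | h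
  · exact hmono s h
  · induction m, h using Nat.le_induction with
    | base => exact le_rfl
    | succ m hm ih =>
      have hm' : (n : ℝ) ≤ m := by exact_mod_cast hm
      have h1 : Ψ (m + 1) s = Ψ m s + c m (Ψ m) * max (s - m) 0 := rfl
      rw [h1, max_eq_right (by linarith)]
      simpa using ih

/-- A Fatou upper set not containing zero is separated from zero by a finite measure. -/
theorem exists_measure_one_le_integral [IsProbabilityMeasure μ] (hU : IsFatouUpperSet μ U)
    (h0 : (fun _ => 0) ∉ U) :
    ∃ ν : Measure X, IsFiniteMeasure ν ∧ ν ≪ μ ∧ ∀ u ∈ U, 1 ≤ ∫ x, u x ∂ν := by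
  obtain ⟨Ψ, hΨ, hΨm, hΨn⟩ := hU.exists_penalty_seq h0
  have hLinf : ∀ v : Lp ℝ ∞ μ, MemLinf μ v := fun v =>
    ⟨(Lp.stronglyMeasurable v).measurable, ‖v‖, ae_norm_le_norm_Lp_top v⟩
  have hint : ∀ n {v : X → ℝ}, MemLinf μ v → Integrable (fun x => Ψ n (v x)) μ := fun n v hv =>
    (hv.comp_continuous (hΨ n).continuous).integrable
  have hintd : ∀ n {v : X → ℝ}, MemLinf μ v → ∀ δ : ℝ, Integrable (fun x => Ψ n (v x + δ)) μ :=
    fun n v hv δ => hint n (hv.add (.const δ))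
  obtain ⟨δ, hδ0, hδ1, hδ⟩ : ∃ δ : ℝ, 0 < δ ∧ δ ≤ 1 ∧ ∀ n, Ψ n δ < 1 / 2 := by
    have h1 : ∀ᶠ s in 𝓝 (0 : ℝ), Ψ 1 s < 1 / 2 :=
      (hΨ 1).continuous.continuousAt.eventually_lt_const (by
        rw [(hΨ 1).eq_zero 0 le_rfl]; norm_num)
    obtain ⟨ε, hε, h2⟩ := Metric.eventually_nhds_iff.1 h1
    refine ⟨min (ε / 2) 1, by positivity, min_le_right _ _, fun n => ?_⟩
    refine (hΨn 1 n _ (by simp)).trans_lt (h2 ?_)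
    rw [Real.dist_eq, sub_zero, abs_of_pos (by positivity)]
    exact (min_le_left _ _).trans_lt (by linarith)
  let B : Set (Lp ℝ ∞ μ) := {v | ∃ δ > 0, ∀ n, ∫ x, Ψ n (v x + δ) ∂μ < 1}
  let T : Set (Lp ℝ ∞ μ) := {v | (v : X → ℝ) ∈ U}
  have hcoe : ∀ (v w : Lp ℝ ∞ μ) (s t : ℝ), ∀ᵐ x ∂μ, (s • v + t • w) x = s * v x + t * w x := by
    intro v w s t
    filter_upwards [Lp.coeFn_add (s • v) (t • w), Lp.coeFn_smul s v,
      Lp.coeFn_smul t w] with x h1 h2 h3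
    rw [h1, Pi.add_apply, h2, h3]
    rfl
  have hBopen : IsOpen B := by
    rw [Metric.isOpen_iff]
    rintro v ⟨η, hη, hv⟩
    refine ⟨η / 2, by positivity, fun w hw => ⟨η / 2, by positivity, fun n => ?_⟩⟩
    refine lt_of_le_of_lt (integral_mono_ae (hintd n (hLinf w) _) (hintd n (hLinf v) _) ?_) (hv n)
    filter_upwards [ae_norm_le_norm_Lp_top (w - v), Lp.coeFn_sub w v] with x h1 h2
    rw [Metric.mem_ball, dist_eq_norm] at hw
    rw [h2, Pi.sub_apply, Real.norm_eq_abs] at h1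
    exact (hΨ n).monotone (by linarith [le_abs_self (w x - v x)])
  have hBconv : Convex ℝ B := by
    rw [convex_iff_forall_pos]
    rintro v ⟨η, hη, hv⟩ w ⟨θ, hθ, hw⟩ s t hs ht hst
    refine ⟨s * η + t * θ, by positivity, fun n => ?_⟩
    have hle : ∫ x, Ψ n ((s • v + t • w : Lp ℝ ∞ μ) x + (s * η + t * θ)) ∂μ
        ≤ ∫ x, (s * Ψ n (v x + η) + t * Ψ n (w x + θ)) ∂μ := by
      refine integral_mono_ae (hintd n (hLinf _) _)
        (((hintd n (hLinf v) _).const_mul s).add ((hintd n (hLinf w) _).const_mul t)) ?_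
      filter_upwards [hcoe v w s t] with x hx
      have := (hΨ n).convexOn.2 (Set.mem_univ (v x + η)) (Set.mem_univ (w x + θ)) hs.le ht.le hst
      simp only [smul_eq_mul] at this
      rw [hx]
      convert this using 2
      ring
    rw [integral_add ((hintd n (hLinf v) _).const_mul s) ((hintd n (hLinf w) _).const_mul t),
      integral_const_mul, integral_const_mul] at hle
    nlinarith [hv n, hw n]
  have hTconv : Convex ℝ T := by
    rw [convex_iff_forall_pos]
    rintro v hv w hw s t hs ht hst
    obtain rfl : t = 1 - s := by linarith
    refine hU.mem_of_ae_eq (hU.convex _ hv _ hw s ⟨hs, by linarith⟩) (hLinf _).1 ?_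
    filter_upwards [hcoe v w s (1 - s)] with x hx using hx.symm
  have hdisj : Disjoint B T := by
    refine Set.disjoint_left.2 ?_
    rintro v ⟨η, hη, hv⟩ hvU
    obtain ⟨n, hn⟩ := exists_nat_ge ‖v‖
    have hmax : (fun x => max (v x) 0) ∈ U :=
      hU.mono _ hvU _ (hLinf v).max_zero (.of_forall fun x => le_max_left _ _)
    have h1 := (hΨ n).one_lt _ hmax (by
      filter_upwards [ae_norm_le_norm_Lp_top v] with x hx
      exact ⟨le_max_right _ _, max_le ((le_abs_self _).trans (hx.trans hn)) n.cast_nonneg⟩)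
    refine lt_asymm h1 (lt_of_le_of_lt
      (integral_mono (hint n (hLinf v).max_zero) (hintd n (hLinf v) η) fun x => ?_) (hv n))
    rcases le_total (v x) 0 with h | h
    · simp only [max_eq_right h]
      rw [(hΨ n).eq_zero 0 le_rfl, ← (hΨ n).eq_zero (min (v x + η) 0) (min_le_right _ _)]
      exact (hΨ n).monotone (min_le_left _ _)
    · simp only [max_eq_left h]
      exact (hΨ n).monotone (by linarith)
  obtain ⟨f, r, hfB, hfT⟩ := geometric_hahn_banach_open hBconv hBopen hTconv hdisj
  have hnegB : ∀ v : Lp ℝ ∞ μ, (∀ᵐ x ∂μ, v x ≤ 0) → v ∈ B := fun v hv => by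
    refine ⟨δ, hδ0, fun n => ?_⟩
    refine lt_of_le_of_lt (integral_mono_ae (hintd n (hLinf v) _)
      (integrable_const (Ψ n δ)) ?_) ?_
    · filter_upwards [hv] with x hx
      exact (hΨ n).monotone (by linarith)
    · simp only [integral_const, probReal_univ, one_smul]
      linarith [hδ n]
  have hr : 0 < r := by
    simpa using hfB 0 (hnegB 0 (by
      filter_upwards [Lp.coeFn_zero ℝ ∞ μ] with x hx
      exact hx.le))
  have hfpos : ∀ v : Lp ℝ ∞ μ, (∀ᵐ x ∂μ, 0 ≤ v x) → 0 ≤ f v := fun v hv => by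
    by_contra! hlt
    have h1 := hfB ((r / f v) • v) (hnegB _ (by
      filter_upwards [hv, Lp.coeFn_smul (r / f v) v] with x h1 h2
      rw [h2, Pi.smul_apply, smul_eq_mul]
      exact mul_nonpos_of_nonpos_of_nonneg (div_neg_of_pos_of_neg hr hlt).le h1))
    rw [map_smul, smul_eq_mul, div_mul_cancel₀ _ hlt.ne] at h1
    exact lt_irrefl _ h1
  classical
  let L : (X → ℝ) → ℝ := fun u => if h : MemLp u ∞ μ then f (h.toLp u) / r else 0
  have hL : ∀ {u} (hu : MemLp u ∞ μ), L u = f (hu.toLp u) / r := fun hu => dif_pos hu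
  have hLmul : ∀ u, MemLinf μ u → ∀ c : ℝ, L (fun x => c * u x) = c * L u := fun u hu c => by
    rw [hL hu.memLp, hL (hu.const_mul c).memLp, ← mul_div_assoc, ← smul_eq_mul (a := c), ← map_smul,
      ← MemLp.toLp_const_smul]
    rfl
  have hLadd : ∀ u v, MemLinf μ u → MemLinf μ v → L (fun x => u x + v x) = L u + L v :=
    fun u v hu hv => by
      rw [hL hu.memLp, hL hv.memLp, hL (hu.add hv).memLp, ← add_div, ← map_add, ← MemLp.toLp_add]
      rfl
  have hLmono : ∀ u v, MemLinf μ u → MemLinf μ v → (∀ᵐ x ∂μ, u x ≤ v x) → L u ≤ L v := by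
    intro u v hu hv huv
    rw [hL hu.memLp, hL hv.memLp]
    refine div_le_div_of_nonneg_right (sub_nonneg.1 ?_) hr.le
    rw [← map_sub, ← MemLp.toLp_sub]
    refine hfpos _ ?_
    filter_upwards [huv, (hv.memLp.sub hu.memLp).coeFn_toLp] with x h1 h2
    rw [h2]
    exact sub_nonneg.2 h1
  obtain ⟨ν, hfin, hac, hν⟩ := exists_measure_of_linear_of_mono L hLadd hLmul hLmono (by
    intro A hA hanti hempty
    have hμA : Tendsto (fun n => μ.real (A n)) atTop (𝓝 0) := by
      have := tendsto_measure_iInter_atTop (μ := μ) (fun n => (hA n).nullMeasurableSet) hanti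
        ⟨0, measure_ne_top _ _⟩
      rw [hempty, measure_empty] at this
      exact (ENNReal.tendsto_toReal_zero_iff fun n => measure_ne_top _ _).2 this
    have hnn : ∀ n, 0 ≤ L ((A n).indicator fun _ => 1) := fun n => by
      have h1 := hLmul _ (.const 0) 0
      rw [zero_mul] at h1
      simp only [zero_mul] at h1
      rw [← h1]
      exact hLmono _ _ (.const 0) (.indicator (hA n))
        (.of_forall fun x => Set.indicator_nonneg (by simp) x)
    refine tendsto_order.2 ⟨fun a ha => .of_forall fun n => ha.trans_le (hnn n), fun ε hε => ?_⟩
    obtain ⟨N, hN⟩ := exists_nat_ge (1 / ε + 1)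
    have hev := (hμA.const_mul (Ψ N N)).eventually_lt_const
      (show Ψ N N * 0 < 1 / 2 by norm_num)
    filter_upwards [hev] with k hk
    have hmem := (MemLinf.indicator (μ := μ) (hA k)).const_mul (1 / ε)
    have hB : hmem.memLp.toLp _ ∈ B := by
      refine ⟨δ, hδ0, fun n => ?_⟩
      have hle : ∫ x, Ψ n (hmem.memLp.toLp _ x + δ) ∂μ
          ≤ ∫ x, (Ψ N N * (A k).indicator (fun _ => (1 : ℝ)) x + Ψ n δ) ∂μ := by
        have hi := (MemLinf.indicator (μ := μ) (hA k)).integrable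
        refine integral_mono_ae (hintd n (hLinf _) _)
          ((hi.const_mul _).add (integrable_const _)) ?_
        filter_upwards [hmem.memLp.coeFn_toLp] with x hx
        rw [hx]
        have hδn : 0 ≤ Ψ n δ := by
          rw [← (hΨ n).eq_zero 0 le_rfl]
          exact (hΨ n).monotone hδ0.le
        by_cases hxA : x ∈ A k
        · simp only [hxA, Set.indicator_of_mem, mul_one]
          have h1 : Ψ n (1 / ε + δ) ≤ Ψ n N := (hΨ n).monotone (by linarith)
          linarith [hΨn N n N le_rfl]
        · simp [hxA]
      rw [integral_add (((MemLinf.indicator (μ := μ) (hA k)).integrable).const_mul _)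
        (integrable_const _), integral_const_mul, integral_indicator_const _ (hA k)] at hle
      simp only [integral_const, probReal_univ, smul_eq_mul, mul_one, one_mul] at hle
      linarith [hδ n]
    have h1 := hfB _ hB
    have h2 := hLmul _ (MemLinf.indicator (μ := μ) (hA k)) (1 / ε)
    rw [hL hmem.memLp] at h2
    have h3 : f (hmem.memLp.toLp _) / r < 1 := (div_lt_one hr).2 h1
    rw [h2, one_div, inv_mul_lt_iff₀ hε] at h3
    linarith)
  refine ⟨ν, hfin, hac, fun u hu => le_trans ?_ (hν u (hU.memLinf u hu))⟩
  have hmem := (hU.memLinf u hu).memLp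
  rw [hL hmem, one_le_div hr]
  refine hfT _ (hU.mem_of_ae_eq hu (hLinf _).1 ?_)
  filter_upwards [hmem.coeFn_toLp] with x hx using hx.symm

end IsFatouUpperSet

section Acceptance

variable {μ : Measure X} {φ : (X → ℝ) → EReal}

theorem IsMonetaryRiskMeasure.exists_eq_coe (hφ : IsMonetaryRiskMeasure μ φ) {f : X → ℝ}
    (hf : MemLinf μ f) : ∃ c : ℝ, φ f = c := by
  obtain ⟨hzero, hmono, htrans⟩ := hφ
  obtain ⟨hfm, C, hC⟩ := hf
  have hconst : ∀ c : ℝ, φ (fun _ => c) = c := fun c => by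
    simpa [hzero] using htrans (fun _ => 0) measurable_const c
  have h1 : φ f ≤ C := by
    rw [← hconst C]
    exact hmono _ _ hfm measurable_const (hC.mono fun x hx => (abs_le.1 hx).2)
  have h2 : ((-C : ℝ) : EReal) ≤ φ f := by
    rw [← hconst (-C)]
    exact hmono _ _ measurable_const hfm (hC.mono fun x hx => (abs_le.1 hx).1)
  refine ⟨(φ f).toReal, (EReal.coe_toReal ?_ ?_).symm⟩
  · exact (h1.trans_lt (EReal.coe_lt_top _)).ne
  · exact ((EReal.bot_lt_coe _).trans_le h2).ne'

/-- If `φ` is convex and continuous from below, the set of `u` such that `g - u` is acceptable is a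
Fatou upper set. -/
theorem isFatouUpperSet_acceptance (hφ : IsMonetaryRiskMeasure μ φ) (hconv : ConvexLinf μ φ)
    (hcont : ContFromBelowLinf μ φ) {g : X → ℝ} (hg : MemLinf μ g) :
    IsFatouUpperSet μ {u | MemLinf μ u ∧ φ (fun x => g x - u x) ≤ 0} where
  memLinf u hu := hu.1
  convex := by
    rintro u ⟨hu, hu0⟩ v ⟨hv, hv0⟩ t ht
    refine ⟨(hu.const_mul t).add (hv.const_mul _), ?_⟩
    have h1 := hconv _ _ (hg.sub hu) (hg.sub hv) t ht
    have h2 : (fun x => g x - (t * u x + (1 - t) * v x))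
        = fun x => t * (g x - u x) + (1 - t) * (g x - v x) := by
      funext x
      ring
    rw [h2]
    refine h1.trans (add_nonpos ?_ ?_)
    · exact mul_nonpos_of_nonneg_of_nonpos (EReal.coe_nonneg.2 ht.1.le) hu0
    · exact mul_nonpos_of_nonneg_of_nonpos (EReal.coe_nonneg.2 (by linarith [ht.2])) hv0
  mono := by
    rintro u ⟨hu, hu0⟩ v hv huv
    refine ⟨hv, (hφ.2.1 _ _ (hg.sub hv).1 (hg.sub hu).1 ?_).trans hu0⟩
    filter_upwards [huv] with x hx
    linarith
  closed := by
    intro u v C hu hC hv huv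
    have hC' : ∀ᵐ x ∂μ, ∀ n, |u n x| ≤ C := ae_all_iff.2 hC
    let w : ℕ → X → ℝ := fun n x => ⨆ k, u (n + k) x
    have hbdd : ∀ x, (∀ n, |u n x| ≤ C) → ∀ n, BddAbove (Set.range fun k => u (n + k) x) :=
      fun x hx n => ⟨C, Set.forall_mem_range.2 fun k => (abs_le.1 (hx _)).2⟩
    have hw : ∀ n, MemLinf μ (w n) := fun n => by
      refine .of_mem_Icc (a := -C) (b := C) (Measurable.iSup fun k => (hu _).1.1) ?_
      filter_upwards [hC'] with x hx
      exact ⟨(abs_le.1 (hx _)).1.trans (le_ciSup (hbdd x hx n) 0),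
        ciSup_le fun k => (abs_le.1 (hx _)).2⟩
    have hsup := hcont (fun n x => g x - w n x) (fun x => g x - v x) (fun n => hg.sub (hw n))
      (hg.sub hv) ?_ ?_
    · refine ⟨hv, hsup ▸ iSup_le fun n => ?_⟩
      refine (hφ.2.1 _ _ (hg.sub (hw n)).1 (hg.sub (hu n).1).1 ?_).trans (hu n).2
      filter_upwards [hC'] with x hx
      have := le_ciSup (hbdd x hx n) 0
      simp only [add_zero] at this
      linarith
    · filter_upwards [hC'] with x hx
      intro m n hmn
      have : w n x ≤ w m x := ciSup_le fun k => by
        have := le_ciSup (hbdd x hx m) (n - m + k)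
        rwa [show m + (n - m + k) = n + k by omega] at this
      simp only
      linarith
    · filter_upwards [hC', huv] with x hx hx'
      refine Tendsto.const_sub _ (Metric.tendsto_atTop.2 fun ε hε => ?_)
      obtain ⟨N, hN⟩ := Metric.tendsto_atTop.1 hx' (ε / 2) (by positivity)
      refine ⟨N, fun n hn => ?_⟩
      have h1 : ∀ k, |u (n + k) x - v x| < ε / 2 := fun k => hN _ (by omega)
      have h2 : w n x ≤ v x + ε / 2 := ciSup_le fun k => by linarith [(abs_lt.1 (h1 k)).2]
      have h3 := le_ciSup (hbdd x hx n) 0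
      have h4 : u (n + 0) x ≤ w n x := h3
      rw [Real.dist_eq, abs_lt]
      constructor <;> linarith [(abs_lt.1 (h1 0)).1]

/-- A bounded function dominated by the density of the conjugate is acceptable. -/
theorem le_zero_of_le_conjugate_density [IsProbabilityMeasure μ]
    (hφ : IsMonetaryRiskMeasure μ φ) (hconv : ConvexLinf μ φ) (hcont : ContFromBelowLinf μ φ)
    {I : X → ℝ≥0∞} (hI : Measurable I)
    (hconj : ∀ ν : Measure X, IsProbabilityMeasure ν → ν ≪ μ →
      (⨆ f : {f : X → ℝ // MemLinf μ f}, (((∫ x, (f : X → ℝ) x ∂ν : ℝ) : EReal) - φ f))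
        = ((∫⁻ x, I x ∂ν : ℝ≥0∞) : EReal))
    {g : X → ℝ} (hg : MemLinf μ g) (hgI : ∀ᵐ x ∂μ, (g x : EReal) ≤ I x) : φ g ≤ 0 := by
  by_contra hpos
  obtain ⟨ν, hfin, hac, hν⟩ := (isFatouUpperSet_acceptance hφ hconv hcont
    hg).exists_measure_one_le_integral (fun h => hpos (by simpa using h.2))
  have hmem : ∀ f : X → ℝ, MemLinf μ f → ∀ c : ℝ, φ f = c →
      1 ≤ ∫ x, (g x - (f x + -c)) ∂ν := fun f hf c hc => by
    refine hν _ ⟨hg.sub (hf.add (.const _)), ?_⟩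
    have h1 : (fun x => g x - (g x - (f x + -c))) = fun x => f x + -c := by
      funext x
      ring
    rw [h1, hφ.2.2 f hf.1, hc, ← EReal.coe_add]
    simp
  have hν0 : ν ≠ 0 := by
    rintro rfl
    obtain ⟨c, hc⟩ := hφ.exists_eq_coe hg
    exact absurd ((hmem g hg c hc).trans_eq (integral_zero_measure _)) (by norm_num)
  have : NeZero ν := ⟨hν0⟩
  let m : ℝ := ν.real Set.univ
  have hm : 0 < m := measureReal_univ_pos
  let P : Measure X := (ν Set.univ)⁻¹ • ν
  have hP : IsProbabilityMeasure P := isProbabilityMeasureSMul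
  have hPac : P ≪ μ := (Measure.smul_absolutelyContinuous).trans hac
  have hPint : ∀ f : X → ℝ, ∫ x, f x ∂P = m⁻¹ * ∫ x, f x ∂ν := fun f => by
    rw [integral_smul_measure, ENNReal.toReal_inv]
    rfl
  have hintP : ∀ {f : X → ℝ}, MemLinf μ f → Integrable f P := fun {f} hf =>
    MemLinf.integrable (⟨hf.1, hf.2.choose, hPac.ae_le hf.2.choose_spec⟩ : MemLinf P f)
  have hle : ((∫⁻ x, I x ∂P : ℝ≥0∞) : EReal) ≤ ((∫ x, g x ∂P - m⁻¹ : ℝ) : EReal) := by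
    rw [← hconj P hP hPac]
    refine iSup_le fun ⟨f, hf⟩ => ?_
    obtain ⟨c, hc⟩ := hφ.exists_eq_coe hf
    have h1 := mul_le_mul_of_nonneg_left (hmem f hf c hc) (inv_nonneg.2 hm.le)
    rw [← hPint, integral_sub (hintP hg) (hintP (hf.add (.const _))),
      integral_add (hintP hf) (integrable_const _)] at h1
    simp only [integral_const, probReal_univ, one_smul, mul_one] at h1
    simp only [hc]
    rw [← EReal.coe_sub]
    exact EReal.coe_le_coe_iff.2 (by linarith)
  have hfinite : ∫⁻ x, I x ∂P ≠ ∞ := fun h => by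
    rw [h] at hle
    exact (EReal.coe_lt_top _).not_ge hle
  have hgle : ∫ x, g x ∂P ≤ (∫⁻ x, I x ∂P).toReal := by
    rw [← integral_toReal hI.aemeasurable (ae_lt_top hI hfinite)]
    refine integral_mono_ae (hintP hg) (integrable_toReal_of_lintegral_ne_top hI.aemeasurable
      hfinite) ?_
    filter_upwards [hPac.ae_le hgI, ae_lt_top hI hfinite] with x h1 h2
    rw [← EReal.coe_ennreal_toReal h2.ne] at h1
    exact EReal.coe_le_coe_iff.1 h1
  rw [← EReal.coe_ennreal_toReal hfinite, EReal.coe_le_coe_iff] at hle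
  linarith [inv_pos.2 hm]

/-- The conjugate inequality bounds `φ` from below by the penalized maximum loss. -/
theorem essSup_sub_le_of_conjugate [IsProbabilityMeasure μ] (hφ : IsMonetaryRiskMeasure μ φ)
    {I : X → ℝ≥0∞} (hI : Measurable I)
    (hconj : ∀ ν : Measure X, IsProbabilityMeasure ν → ν ≪ μ →
      (⨆ f : {f : X → ℝ // MemLinf μ f}, (((∫ x, (f : X → ℝ) x ∂ν : ℝ) : EReal) - φ f))
        = ((∫⁻ x, I x ∂ν : ℝ≥0∞) : EReal))
    {f : X → ℝ} (hf : MemLinf μ f) :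
    essSup (fun x => (f x : EReal) - (I x : EReal)) μ ≤ φ f := by
  obtain ⟨c, hc⟩ := hφ.exists_eq_coe hf
  rw [hc]
  refine EReal.le_of_forall_lt_iff_le.1 fun d hd => ?_
  rw [EReal.coe_lt_coe_iff] at hd
  refine essSup_le_of_ae_le _ ?_
  let A : Set X := {x | I x ≤ ENNReal.ofReal (f x - d) ∧ d ≤ f x}
  have hA : MeasurableSet A :=
    (measurableSet_le hI (hf.1.sub_const d).ennreal_ofReal).inter
      (measurableSet_le measurable_const hf.1)
  have hA0 : μ A = 0 := by
    by_contra hne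
    let P : Measure X := ProbabilityTheory.cond μ A
    have hP : IsProbabilityMeasure P := ProbabilityTheory.cond_isProbabilityMeasure hne
    have hPac : P ≪ μ := ProbabilityTheory.cond_absolutelyContinuous
    have hPA : ∀ᵐ x ∂P, x ∈ A := ProbabilityTheory.ae_cond_mem hA
    have hint : Integrable f P :=
      MemLinf.integrable (⟨hf.1, hf.2.choose, hPac.ae_le hf.2.choose_spec⟩ : MemLinf P f)
    have h1 : ∫⁻ x, I x ∂P ≤ ENNReal.ofReal (∫ x, f x ∂P - d) := by
      have h2 : ∫ x, f x ∂P - d = ∫ x, (f x - d) ∂P := by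
        rw [integral_sub hint (integrable_const _)]
        simp
      rw [h2, ofReal_integral_eq_lintegral_ofReal (f := fun x => f x - d)
        (hint.sub (integrable_const _))
        (hPA.mono fun x hx => sub_nonneg.2 hx.2)]
      exact lintegral_mono_ae (hPA.mono fun x hx => hx.1)
    have h3 : d ≤ ∫ x, f x ∂P := by
      have := integral_mono_ae (integrable_const d) hint (hPA.mono fun x hx => hx.2)
      simpa using this
    have h4 : ((∫ x, f x ∂P : ℝ) : EReal) - φ f ≤ ((∫⁻ x, I x ∂P : ℝ≥0∞) : EReal) := by
      rw [← hconj P hP hPac]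
      exact le_iSup (fun f : {f : X → ℝ // MemLinf μ f} =>
        (((∫ x, (f : X → ℝ) x ∂P : ℝ) : EReal) - φ f)) ⟨f, hf⟩
    have h5 := h4.trans (EReal.coe_ennreal_le_coe_ennreal_iff.2 h1)
    rw [EReal.coe_ennreal_ofReal, max_eq_left (by linarith), hc, ← EReal.coe_sub,
      EReal.coe_le_coe_iff] at h5
    linarith
  filter_upwards [measure_eq_zero_iff_ae_notMem.1 hA0] with x hx
  refine EReal.sub_le_of_le_add' ?_
  by_cases hd' : d ≤ f x
  · have hlt : ENNReal.ofReal (f x - d) < I x := not_le.1 fun h => hx ⟨h, hd'⟩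
    have h1 := (EReal.coe_ennreal_le_coe_ennreal_iff.2 hlt.le)
    rw [EReal.coe_ennreal_ofReal, max_eq_left (by linarith)] at h1
    calc (f x : EReal) = ((f x - d : ℝ) : EReal) + d := by rw [← EReal.coe_add]; simp
      _ ≤ I x + d := by gcongr
  · calc (f x : EReal) ≤ (0 : EReal) + d := by
          rw [zero_add]; exact EReal.coe_le_coe_iff.2 (not_le.1 hd').le
      _ ≤ I x + d := by gcongr; exact EReal.coe_ennreal_nonneg _

end Acceptance

/-- If `φ|_{L^∞}` is a convex monetary risk measure, continuous from below, whose convex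
conjugate is `ν ↦ ∫ I dν` on the probability measures `ν ≪ μ`, then `φ` is the penalized
maximum loss `f ↦ ess.sup_X (f - I)` on `L^∞`. -/
theorem convex_contFromBelow_conjugate_rep
    (μ : Measure X) [IsProbabilityMeasure μ]
    (φ : (X → ℝ) → EReal) (hφ : IsMonetaryRiskMeasure μ φ)
    (hconv : ConvexLinf μ φ) (hcont : ContFromBelowLinf μ φ)
    (I : X → ℝ≥0∞) (hI : Measurable I)
    (hconj : ∀ ν : Measure X, IsProbabilityMeasure ν → ν ≪ μ →
      (⨆ f : {f : X → ℝ // MemLinf μ f}, (((∫ x, (f : X → ℝ) x ∂ν : ℝ) : EReal) - φ f))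
        = ((∫⁻ x, I x ∂ν : ℝ≥0∞) : EReal)) :
    ∀ f : X → ℝ, MemLinf μ f →
      φ f = essSup (fun x => (f x : EReal) - (I x : EReal)) μ := by
  intro f hf
  refine le_antisymm (le_of_not_gt fun hlt => ?_) (essSup_sub_le_of_conjugate hφ hI hconj hf)
  obtain ⟨c, hc1, hc2⟩ := EReal.lt_iff_exists_real_btwn.1 hlt
  have hle : φ (fun x => f x + -c) ≤ 0 := by
    refine le_zero_of_le_conjugate_density hφ hconv hcont hI hconj (hf.add (.const _)) ?_
    filter_upwards [_root_.ae_le_essSup (μ := μ) (f := fun x => (f x : EReal) - (I x : EReal))]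
      with x hx
    have h1 : (f x : EReal) ≤ c + I x :=
      (EReal.sub_le_iff_le_add (by simp) (by simp)).1 (hx.trans hc1.le)
    rw [EReal.coe_add, EReal.coe_neg, ← sub_eq_add_neg]
    exact EReal.sub_le_of_le_add' h1
  rw [hφ.2.2 f hf.1] at hle
  obtain ⟨d, hd⟩ := hφ.exists_eq_coe hf
  rw [hd, EReal.coe_lt_coe_iff] at hc2
  rw [hd, ← EReal.coe_add, ← EReal.coe_zero, EReal.coe_le_coe_iff] at hle
  linarith
end
end

section
/- Let φ : L⁰ → [−∞,∞] be a monetary risk measure whose concentration satisfies J_A = 0 for every A ∈ 𝒳 with μ(A) > 0. Then φ(f) = ess.sup_X f for every f ∈ L^∞. -/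
open MeasureTheory Filter Set Topology ENNReal

noncomputable section

variable {X : Type*} [MeasurableSpace X]

/-- The concentration of `φ`: `J_A = inf_{r<0} φ (r · 1_{Aᶜ})`. -/
def conc (φ : (X → ℝ) → EReal) (A : Set X) : EReal :=
  ⨅ r : {r : ℝ // r < 0}, φ (Aᶜ.indicator fun _ => (r : ℝ))

/-- A monetary risk measure fixes constants. -/
lemma IsMonetaryRiskMeasure.map_const {μ : Measure X} {φ : (X → ℝ) → EReal}
    (hφ : IsMonetaryRiskMeasure μ φ) (c : ℝ) : φ (fun _ => c) = c := by
  have h := hφ.2.2 (fun _ => 0) measurable_const c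
  simpa [hφ.1] using h

/-- A function bounded below whose concentration on `{c < f}` vanishes has risk at least `c`. -/
lemma IsMonetaryRiskMeasure.le_of_conc_eq_zero {μ : Measure X} {φ : (X → ℝ) → EReal}
    (hφ : IsMonetaryRiskMeasure μ φ) {f : X → ℝ} (hf : Measurable f) {C : ℝ}
    (hC : ∀ᵐ x ∂μ, -C ≤ f x) {c : ℝ} (hc : conc φ {x | c < f x} = 0) : (c : EReal) ≤ φ f := by
  set A : Set X := {x | c < f x}
  have hA : MeasurableSet A := measurableSet_lt measurable_const hf
  set r : ℝ := min (-C - c) (-1)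
  have hr : r < 0 := (min_le_right _ _).trans_lt (by norm_num)
  have hg : Measurable (Aᶜ.indicator fun _ => r) := measurable_const.indicator hA.compl
  have h0 : 0 ≤ φ (Aᶜ.indicator fun _ => r) :=
    hc ▸ iInf_le (fun r : {r : ℝ // r < 0} => φ (Aᶜ.indicator fun _ => (r : ℝ))) ⟨r, hr⟩
  calc (c : EReal) = 0 + c := (zero_add _).symm
    _ ≤ φ (Aᶜ.indicator fun _ => r) + c := by gcongr
    _ = φ (fun x => Aᶜ.indicator (fun _ => r) x + c) := (hφ.2.2 _ hg c).symm
    _ ≤ φ f := by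
      refine hφ.2.1 _ _ (hg.add_const c) hf ?_
      filter_upwards [hC] with x hx
      by_cases hxA : x ∈ A
      · simpa [hxA] using le_of_lt hxA
      · have : r ≤ -C - c := min_le_left _ _
        simp only [indicator_of_mem (mem_compl hxA)]
        linarith

/-- If the concentration of a monetary risk measure `φ` satisfies `J_A = 0` whenever
`μ A > 0`, then `φ` is the maximum loss `f ↦ ess.sup_X f` on `L^∞`. -/
theorem concentration_zero_maximumLoss
    (μ : Measure X) [IsProbabilityMeasure μ]
    (φ : (X → ℝ) → EReal) (hφ : IsMonetaryRiskMeasure μ φ)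
    (hJ : ∀ A : Set X, MeasurableSet A → 0 < μ A → conc φ A = 0) :
    ∀ f : X → ℝ, MemLinf μ f → φ f = essSup (fun x => (f x : EReal)) μ := by
  intro f ⟨hf, C, hC⟩
  apply le_antisymm
  · refine EReal.le_of_forall_lt_iff_le.mp fun z hz => ?_
    rw [← hφ.map_const z]
    refine hφ.2.1 _ _ hf measurable_const ?_
    filter_upwards [ae_le_essSup (f := fun x => (f x : EReal)) (μ := μ)] with x hx
    exact EReal.coe_le_coe_iff.mp (hx.trans hz.le)
  · refine EReal.ge_of_forall_gt_iff_ge.mp fun z hz => ?_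
    refine hφ.le_of_conc_eq_zero hf (hC.mono fun x hx => (abs_le.mp hx).1)
      (hJ _ (measurableSet_lt measurable_const hf) (pos_iff_ne_zero.mpr fun h0 => hz.not_ge ?_))
    refine essSup_le_of_ae_le _ ?_
    have h : ∀ᵐ x ∂μ, ¬ z < f x := by simpa [ae_iff] using h0
    filter_upwards [h] with x hx
    exact EReal.coe_le_coe_iff.mpr (not_lt.mp hx)
end
end
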